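/- arXiv:1706.03139 — 2 statements merged into one kernel-verified Lean document; each statement's English description precedes it below -/
import Mathlib

section
/- For H ∈ (1/2, 1), a > 0 and T > 0, the integral of the ε-scaled fOU kernel is of exact order ε^{1−H}: lim_{ε → 0⁺} ε^{H−1} · ∫₀^T ε^{−1/2}·K(s/ε) ds = T^{H−1/2}/(a·Γ(H+1/2)). -/
open Real MeasureTheory Set Filter Topology

/-- The fOU moving-average kernel
`K(t) = (1/Γ(H+1/2)) · (t^{H−1/2} − a ∫₀^t (t−s)^{H−1/2} e^{−a s} ds)`. -/
noncomputable def fouKernel (H a t : ℝ) : ℝ :=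
  (1 / Real.Gamma (H + 1 / 2)) *
    (t ^ (H - 1 / 2) - a * ∫ s in (0 : ℝ)..t, (t - s) ^ (H - 1 / 2) * Real.exp (-a * s))

lemma integral_sub_rpow_mul_exp (p a t : ℝ) :
    ∫ s in (0 : ℝ)..t, (t - s) ^ p * exp (-a * s) =
      exp (-a * t) * ∫ u in (0 : ℝ)..t, u ^ p * exp (a * u) := by
  have h := intervalIntegral.integral_comp_sub_left (a := 0) (b := t)
    (fun u => u ^ p * exp (-a * (t - u))) t
  simp only [sub_sub_cancel, sub_self, sub_zero] at h
  rw [h, ← intervalIntegral.integral_const_mul]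
  congr 1 with u
  rw [show -a * (t - u) = -a * t + a * u by ring, exp_add]
  ring

lemma hasDerivAt_integral_sub_rpow_mul_exp {p : ℝ} (hp : 0 ≤ p) (a t : ℝ) :
    HasDerivAt (fun t => ∫ s in (0 : ℝ)..t, (t - s) ^ p * exp (-a * s))
      (t ^ p - a * ∫ s in (0 : ℝ)..t, (t - s) ^ p * exp (-a * s)) t := by
  simp only [integral_sub_rpow_mul_exp]
  have hc : Continuous fun u : ℝ => u ^ p * exp (a * u) :=
    (continuous_rpow_const hp).mul (by fun_prop)
  have h₁ : HasDerivAt (fun t => ∫ u in (0 : ℝ)..t, u ^ p * exp (a * u))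
      (t ^ p * exp (a * t)) t := (hc.integral_hasStrictDerivAt 0 t).hasDerivAt
  have h₂ : HasDerivAt (fun t : ℝ => exp (-a * t)) (exp (-a * t) * -a) t := by
    simpa using ((hasDerivAt_id t).const_mul (-a)).exp
  have he : exp (-a * t) * exp (a * t) = 1 := by rw [← exp_add]; simp
  refine (h₂.mul h₁).congr_deriv ?_
  linear_combination t ^ p * he

lemma continuous_fouKernel {H : ℝ} (hH : 1 / 2 < H) (a : ℝ) : Continuous (fouKernel H a) := by
  have hp : 0 ≤ H - 1 / 2 := by linarith
  have hc : Continuous fun t => ∫ s in (0 : ℝ)..t, (t - s) ^ (H - 1 / 2) * exp (-a * s) :=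
    continuous_iff_continuousAt.2 fun t =>
      (hasDerivAt_integral_sub_rpow_mul_exp hp a t).continuousAt
  exact continuous_const.mul ((continuous_rpow_const hp).sub (continuous_const.mul hc))

/-- The fOU kernel is, up to `1/Γ(H+1/2)`, the derivative of the convolution of `u^{H−1/2}` with
`e^{−a s}`; this gives its primitive. -/
lemma integral_fouKernel {H : ℝ} (hH : 1 / 2 < H) (a x : ℝ) :
    ∫ t in (0 : ℝ)..x, fouKernel H a t =
      1 / Gamma (H + 1 / 2) * ∫ s in (0 : ℝ)..x, (x - s) ^ (H - 1 / 2) * exp (-a * s) := by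
  have hp : 0 ≤ H - 1 / 2 := by linarith
  have h := intervalIntegral.integral_eq_sub_of_hasDerivAt
    (fun t _ => (hasDerivAt_integral_sub_rpow_mul_exp hp a t).const_mul (1 / Gamma (H + 1 / 2)))
    ((continuous_fouKernel hH a).intervalIntegrable 0 x)
  rwa [intervalIntegral.integral_same, mul_zero, sub_zero] at h

lemma tendsto_rpow_neg_mul_integral_sub_rpow_mul_exp {p a : ℝ} (hp : 0 < p) (ha : 0 < a) :
    Tendsto (fun x : ℝ => x ^ (-p) * ∫ s in (0 : ℝ)..x, (x - s) ^ p * exp (-a * s))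
      atTop (𝓝 (1 / a)) := by
  have hlim : ∫ s in Ioi (0 : ℝ), exp (-a * s) = 1 / a := by
    rw [integral_exp_mul_Ioi (by linarith)]
    simp
  have hdom : Tendsto (fun x : ℝ => ∫ s in Ioi (0 : ℝ), max 0 (1 - s / x) ^ p * exp (-a * s))
      atTop (𝓝 (∫ s in Ioi (0 : ℝ), exp (-a * s))) := by
    refine tendsto_integral_filter_of_dominated_convergence (fun s => exp (-a * s)) ?_ ?_
      (exp_neg_integrableOn_Ioi 0 ha) ?_
    · refine Eventually.of_forall fun x => Continuous.aestronglyMeasurable ?_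
      exact ((continuous_rpow_const hp.le).comp (by fun_prop)).mul (by fun_prop)
    · filter_upwards [eventually_gt_atTop 0] with x hx
      filter_upwards [ae_restrict_mem measurableSet_Ioi] with s hs
      have hs : 0 < s := hs
      have h₀ : 0 ≤ max 0 (1 - s / x) := le_max_left _ _
      have h₁ : max 0 (1 - s / x) ≤ 1 := max_le zero_le_one (by linarith [div_pos hs hx])
      rw [norm_of_nonneg (by positivity)]
      exact mul_le_of_le_one_left (exp_pos _).le (rpow_le_one h₀ h₁ hp.le)
    · refine Eventually.of_forall fun s => ?_
      have h : Tendsto (fun x : ℝ => max 0 (1 - s / x)) atTop (𝓝 (max 0 (1 - 0))) :=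
        tendsto_const_nhds.max (tendsto_const_nhds.sub (tendsto_id.const_div_atTop s))
      simpa using (h.rpow_const (p := p) (Or.inr hp.le)).mul_const (exp (-a * s))
  rw [hlim] at hdom
  refine hdom.congr' ?_
  filter_upwards [eventually_gt_atTop 0] with x hx
  rw [intervalIntegral.integral_of_le hx.le, ← integral_const_mul,
    setIntegral_eq_of_subset_of_forall_sdiff_eq_zero measurableSet_Ioi
      (Ioc_subset_Ioi_self : Ioc 0 x ⊆ Ioi 0)]
  · refine setIntegral_congr_fun measurableSet_Ioc fun s hs => ?_
    have h : 1 - s / x = (x - s) / x := by field_simp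
    have hxs : 0 ≤ x - s := sub_nonneg.2 hs.2
    rw [h, max_eq_right (by positivity), div_rpow hxs hx.le, rpow_neg hx.le]
    ring
  · rintro s ⟨hs, hsx⟩
    have hxs : x < s := by
      by_contra! hle
      exact hsx ⟨hs, hle⟩
    rw [max_eq_left (by linarith [(one_lt_div hx).2 hxs]), zero_rpow hp.ne', zero_mul]

/-- For `H ∈ (1/2,1)`, `a > 0`, `T > 0`, the integral of the ε-scaled fOU kernel is of exact
order `ε^{1−H}`: `lim_{ε → 0⁺} ε^{H−1} ∫₀^T ε^{−1/2} K(s/ε) ds = T^{H−1/2}/(a Γ(H+1/2))`. -/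
theorem scaled_fouKernel_integral_order (H a T : ℝ)
    (hH : 1 / 2 < H) (hH1 : H < 1) (ha : 0 < a) (hT : 0 < T) :
    Tendsto
      (fun ε : ℝ => ε ^ (H - 1) * ∫ s in (0 : ℝ)..T, ε ^ (-(1 / 2) : ℝ) * fouKernel H a (s / ε))
      (𝓝[>] (0 : ℝ))
      (𝓝 (T ^ (H - 1 / 2) / (a * Real.Gamma (H + 1 / 2)))) := by
  have hp : 0 < H - 1 / 2 := by linarith
  have hx : Tendsto (fun ε : ℝ => T / ε) (𝓝[>] 0) atTop := by
    simpa only [div_eq_mul_inv] using tendsto_inv_nhdsGT_zero.const_mul_atTop hT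
  have h := ((tendsto_rpow_neg_mul_integral_sub_rpow_mul_exp hp ha).comp hx).const_mul
    (T ^ (H - 1 / 2) / Gamma (H + 1 / 2))
  have hlim : T ^ (H - 1 / 2) / Gamma (H + 1 / 2) * (1 / a) =
      T ^ (H - 1 / 2) / (a * Gamma (H + 1 / 2)) := by
    rw [div_mul_div_comm, mul_one, mul_comm a]
  rw [hlim] at h
  refine h.congr' ?_
  filter_upwards [self_mem_nhdsWithin] with ε hε
  have hε : 0 < ε := hε
  have hpow : T ^ (H - 1 / 2) * (T / ε) ^ (-(H - 1 / 2)) =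
      ε ^ (H - 1) * (ε ^ (-(1 / 2) : ℝ) * ε) := by
    rw [rpow_neg (by positivity), div_rpow hT.le hε.le, inv_div, ← rpow_add_one hε.ne',
      ← rpow_add hε, mul_div_cancel₀ _ (rpow_pos_of_pos hT _).ne']
    congr 1
    ring
  rw [intervalIntegral.integral_const_mul, intervalIntegral.integral_comp_div _ hε.ne', zero_div,
    integral_fouKernel hH, smul_eq_mul]
  simp only [Function.comp_apply]
  set I := ∫ s in (0 : ℝ)..T / ε, (T / ε - s) ^ (H - 1 / 2) * exp (-a * s)
  linear_combination I / Gamma (H + 1 / 2) * hpow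
end

section
/- For H ∈ (1/2, 1), a > 0 and T > 0, there exists a constant C > 0 such that for all ε ∈ (0,1] and all 0 ≤ l ≤ r ≤ T one has ∫_l^r ε^{−1/2}·K(u/ε) du ≤ C·ε^{1−H}; that is, integrals of the ε-scaled fOU kernel over subintervals of [0,T] are of order ε^{1−H} uniformly in the endpoints. -/
open Real MeasureTheory Set Filter

/-- The fOU kernel is bounded above by a multiple of `t ^ (H - 3 / 2)` on `(0, ∞)`. -/
theorem fouKernel_le {H a t : ℝ} (hH : 1 / 2 < H) (hH1 : H < 1) (ha : 0 < a) (ht : 0 < t) :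
    fouKernel H a t ≤ 1 / (Real.Gamma (H + 1 / 2) * a) * t ^ (H - 3 / 2) := by
  have hΓ : 0 < Real.Gamma (H + 1 / 2) := Real.Gamma_pos_of_pos (by linarith)
  have hlin : ∫ s in (0 : ℝ)..t, a * ((1 - s / t) * Real.exp (-a * s)) =
      Real.exp (-a * t) / (a * t) + 1 - 1 / (a * t) := by
    have hderiv : ∀ s ∈ Set.uIcc 0 t, HasDerivAt
        (fun s : ℝ => -((1 - s / t) * Real.exp (-a * s)) + Real.exp (-a * s) / (a * t))
        (a * ((1 - s / t) * Real.exp (-a * s))) s := by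
      intro s _
      have he : HasDerivAt (fun s : ℝ => Real.exp (-a * s)) (Real.exp (-a * s) * (-a * 1)) s :=
        ((hasDerivAt_id s).const_mul (-a)).exp
      have hl : HasDerivAt (fun s : ℝ => 1 - s / t) (-(1 / t)) s :=
        ((hasDerivAt_id s).div_const t).const_sub 1
      refine ((hl.mul he).neg.add (he.div_const (a * t))).congr_deriv ?_
      field_simp
      ring
    rw [intervalIntegral.integral_eq_sub_of_hasDerivAt hderiv
      (Continuous.intervalIntegrable (by fun_prop) _ _)]
    simp [ht.ne']
    ring
  have hmono : ∫ s in (0 : ℝ)..t, t ^ (H - 1 / 2) * ((1 - s / t) * Real.exp (-a * s)) ≤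
      ∫ s in (0 : ℝ)..t, (t - s) ^ (H - 1 / 2) * Real.exp (-a * s) := by
    apply intervalIntegral.integral_mono_on ht.le
    · exact Continuous.intervalIntegrable (by fun_prop) _ _
    · refine Continuous.intervalIntegrable ?_ _ _
      exact ((continuous_const.sub continuous_id).rpow_const
        fun _ => Or.inr (by linarith)).mul (by fun_prop)
    · intro s hs
      have h0 : 0 ≤ 1 - s / t := by
        rw [sub_nonneg, div_le_one ht]
        exact hs.2
      have h1 : 1 - s / t ≤ 1 := by
        have := div_nonneg hs.1 ht.le
        linarith
      have hpow : 1 - s / t ≤ (1 - s / t) ^ (H - 1 / 2) :=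
        Real.self_le_rpow_of_le_one h0 h1 (by linarith)
      have hfac : t - s = t * (1 - s / t) := by field_simp
      rw [hfac, Real.mul_rpow ht.le h0, ← mul_assoc]
      gcongr
  rw [intervalIntegral.integral_const_mul] at hlin hmono
  have hpow : t ^ (H - 1 / 2) = t ^ (H - 3 / 2) * t := by
    rw [← Real.rpow_add_one ht.ne']
    ring_nf
  have hp : 0 < t ^ (H - 3 / 2) := Real.rpow_pos_of_pos ht _
  have hmain : t ^ (H - 1 / 2) -
      a * ∫ s in (0 : ℝ)..t, (t - s) ^ (H - 1 / 2) * Real.exp (-a * s) ≤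
      1 / a * t ^ (H - 3 / 2) := by
    calc _ ≤ t ^ (H - 1 / 2) - a * (t ^ (H - 1 / 2) *
          ∫ s in (0 : ℝ)..t, (1 - s / t) * Real.exp (-a * s)) := by gcongr
      _ = t ^ (H - 1 / 2) * (1 - a * ∫ s in (0 : ℝ)..t, (1 - s / t) * Real.exp (-a * s)) := by
        ring
      _ = 1 / a * t ^ (H - 3 / 2) * (1 - Real.exp (-a * t)) := by
        rw [hlin, hpow]
        field_simp
        ring
      _ ≤ 1 / a * t ^ (H - 3 / 2) :=
        mul_le_of_le_one_right (by positivity) (by linarith [Real.exp_pos (-a * t)])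
  calc fouKernel H a t ≤ 1 / Real.Gamma (H + 1 / 2) * (1 / a * t ^ (H - 3 / 2)) :=
        mul_le_mul_of_nonneg_left hmain (by positivity)
    _ = _ := by field_simp

/-- For `H ∈ (1/2,1)`, `a > 0`, `T > 0`, there is a constant `C > 0` such that for all
`ε ∈ (0,1]` and all `0 ≤ l ≤ r ≤ T` one has `∫_l^r ε^{−1/2} K(u/ε) du ≤ C ε^{1−H}`. -/
theorem scaled_fouKernel_integral_uniform_bound (H a T : ℝ)
    (hH : 1 / 2 < H) (hH1 : H < 1) (ha : 0 < a) (hT : 0 < T) :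
    ∃ C : ℝ, 0 < C ∧ ∀ ε ∈ Set.Ioc (0 : ℝ) 1, ∀ l r : ℝ, 0 ≤ l → l ≤ r → r ≤ T →
      (∫ u in l..r, ε ^ (-(1 / 2) : ℝ) * fouKernel H a (u / ε)) ≤ C * ε ^ (1 - H) := by
  have hΓ : 0 < Real.Gamma (H + 1 / 2) := Real.Gamma_pos_of_pos (by linarith)
  have hb : 0 < H - 1 / 2 := by linarith
  set c : ℝ := 1 / (Real.Gamma (H + 1 / 2) * a) with hc
  have hc0 : 0 < c := by positivity
  refine ⟨c * (T ^ (H - 1 / 2) / (H - 1 / 2)), by positivity, ?_⟩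
  rintro ε ⟨hε, -⟩ l r hl hlr hr
  have hεp : 0 < ε ^ (1 - H) := Real.rpow_pos_of_pos hε _
  by_cases hint : IntervalIntegrable
      (fun u => ε ^ (-(1 / 2) : ℝ) * fouKernel H a (u / ε)) volume l r
  swap
  · rw [intervalIntegral.integral_undef hint]
    positivity
  have hle : ∀ u ∈ Set.Ioo l r, ε ^ (-(1 / 2) : ℝ) * fouKernel H a (u / ε) ≤
      c * ε ^ (1 - H) * u ^ (H - 3 / 2) := by
    intro u hu
    have hu0 : 0 < u := hl.trans_lt hu.1
    have hscale : ε ^ (-(1 / 2) : ℝ) = ε ^ (1 - H) * ε ^ (H - 3 / 2) := by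
      rw [← Real.rpow_add hε]
      ring_nf
    have hεq : 0 < ε ^ (H - 3 / 2) := Real.rpow_pos_of_pos hε _
    calc _ ≤ ε ^ (-(1 / 2) : ℝ) * (c * (u / ε) ^ (H - 3 / 2)) := by
          gcongr
          exact fouKernel_le hH hH1 ha (by positivity)
      _ = _ := by
          rw [hscale, Real.div_rpow hu0.le hε.le]
          field_simp
  calc _ ≤ ∫ u in l..r, c * ε ^ (1 - H) * u ^ (H - 3 / 2) :=
        intervalIntegral.integral_mono_on_of_le_Ioo hlr hint
          ((intervalIntegral.intervalIntegrable_rpow' (by linarith)).const_mul _) hle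
    _ = c * ε ^ (1 - H) * ((r ^ (H - 1 / 2) - l ^ (H - 1 / 2)) / (H - 1 / 2)) := by
        rw [intervalIntegral.integral_const_mul, integral_rpow (Or.inl (by linarith)),
          show H - 3 / 2 + 1 = H - 1 / 2 by ring]
    _ ≤ c * ε ^ (1 - H) * (T ^ (H - 1 / 2) / (H - 1 / 2)) := by
        have hlp : 0 ≤ l ^ (H - 1 / 2) := Real.rpow_nonneg hl _
        have hrp : r ^ (H - 1 / 2) ≤ T ^ (H - 1 / 2) :=
          Real.rpow_le_rpow (hl.trans hlr) hr hb.le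
        gcongr
        linarith
    _ = _ := by ring
end
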